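/- arXiv:1211.2532 — 2 statements merged into one kernel-verified Lean document; each statement's English description precedes it below -/
import Mathlib

section
/- Let p ≥ 1, let S be a p×p real symmetric positive semidefinite matrix, let ρ > 0 and set α = 1/(‖S‖₂ + pρ). Let Θ* be a p×p real symmetric positive definite matrix with αI ⪯ Θ* which is a fixed point of the G-ISTA step for every step size ζ ∈ (0, α²], i.e. Θ* = η_{ζρ}(Θ* − ζ(S − Θ*⁻¹)) for all such ζ. Let Θ₀ be symmetric positive definite with αI ⪯ Θ₀, let ζ_t ∈ (0, α²] for all t, and define the iterates Θ_{t+1} = η_{ζ_t ρ}(Θ_t − ζ_t(S − Θ_t⁻¹)). Then for every t, αI ⪯ Θ_t ⪯ b′I, where b′ = ‖Θ*‖₂ + ‖Θ₀ − Θ*‖_F. -/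
open Matrix

/-- Entrywise soft-thresholding operator `η_c`. -/
noncomputable def softThresh {n : Type*} [Fintype n] (c : ℝ) (X : Matrix n n ℝ) :
    Matrix n n ℝ :=
  fun i j => Real.sign (X i j) * max (|X i j| - c) 0

/-- Frobenius norm of a real matrix. -/
noncomputable def frobNorm {n : Type*} [Fintype n] (A : Matrix n n ℝ) : ℝ :=
  Real.sqrt (∑ i, ∑ j, (A i j) ^ 2)

/-- Smallest eigenvalue of a real symmetric matrix (as the infimum of the
Rayleigh quotient over the unit sphere). -/
noncomputable def lmin {n : Type*} [Fintype n] (A : Matrix n n ℝ) : ℝ :=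
  ⨅ x : {x : n → ℝ // ∑ i, (x i) ^ 2 = 1}, x.1 ⬝ᵥ A.mulVec x.1

/-- Largest eigenvalue of a real symmetric matrix. -/
noncomputable def lmax {n : Type*} [Fintype n] (A : Matrix n n ℝ) : ℝ :=
  ⨆ x : {x : n → ℝ // ∑ i, (x i) ^ 2 = 1}, x.1 ⬝ᵥ A.mulVec x.1

/-- Spectral norm (largest singular value) of a real matrix. -/
noncomputable def specNorm {n : Type*} [Fintype n] (A : Matrix n n ℝ) : ℝ :=
  ⨆ x : {x : n → ℝ // ∑ i, (x i) ^ 2 = 1}, Real.sqrt (∑ i, (A.mulVec x.1 i) ^ 2)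

theorem abs_sign_mul_max_sub_le {c : ℝ} (hc : 0 ≤ c) (x : ℝ) :
    |Real.sign x * max (|x| - c) 0 - x| ≤ c := by
  rcases lt_trichotomy x 0 with hx | rfl | hx
  · rw [Real.sign_of_neg hx, abs_of_neg hx]
    rcases max_cases (-x - c) 0 with ⟨h, _⟩ | ⟨h, _⟩ <;> rw [h, abs_le] <;> constructor <;> linarith
  · simpa using hc
  · rw [Real.sign_of_pos hx, abs_of_pos hx]
    rcases max_cases (x - c) 0 with ⟨h, _⟩ | ⟨h, _⟩ <;> rw [h, abs_le] <;> constructor <;> linarith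

theorem sign_mul_max_eq {c : ℝ} (hc : 0 ≤ c) (x : ℝ) :
    Real.sign x * max (|x| - c) 0 = max (x - c) 0 - max (-x - c) 0 := by
  rcases lt_trichotomy x 0 with hx | rfl | hx
  · rw [Real.sign_of_neg hx, abs_of_neg hx, max_eq_right (by linarith : x - c ≤ 0)]
    ring
  · simp
  · rw [Real.sign_of_pos hx, abs_of_pos hx, max_eq_right (by linarith : -x - c ≤ 0)]
    ring

theorem abs_sign_mul_max_sub_sign_mul_max_le {c : ℝ} (hc : 0 ≤ c) (x y : ℝ) :
    |Real.sign x * max (|x| - c) 0 - Real.sign y * max (|y| - c) 0| ≤ |x - y| := by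
  rw [sign_mul_max_eq hc, sign_mul_max_eq hc]
  rcases max_cases (x - c) 0 with ⟨h1, _⟩ | ⟨h1, _⟩ <;>
  rcases max_cases (-x - c) 0 with ⟨h2, _⟩ | ⟨h2, _⟩ <;>
  rcases max_cases (y - c) 0 with ⟨h3, _⟩ | ⟨h3, _⟩ <;>
  rcases max_cases (-y - c) 0 with ⟨h4, _⟩ | ⟨h4, _⟩ <;>
  rw [h1, h2, h3, h4] <;>
  rcases abs_cases (x - y) with ⟨h, _⟩ | ⟨h, _⟩ <;> rw [h, abs_le] <;> constructor <;> linarith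

section Norms

variable {n : Type*} [Fintype n]

theorem frobNorm_nonneg (A : Matrix n n ℝ) : 0 ≤ frobNorm A :=
  Real.sqrt_nonneg _

theorem specNorm_nonneg (A : Matrix n n ℝ) : 0 ≤ specNorm A :=
  Real.iSup_nonneg fun _ => Real.sqrt_nonneg _

theorem frobNorm_sq (A : Matrix n n ℝ) : frobNorm A ^ 2 = (Aᵀ * A).trace := by
  rw [frobNorm, Real.sq_sqrt (by positivity), Finset.sum_comm]
  simp [Matrix.trace, Matrix.mul_apply, sq]

theorem frobNorm_le_frobNorm {A B : Matrix n n ℝ} (h : ∀ i j, |A i j| ≤ |B i j|) :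
    frobNorm A ≤ frobNorm B :=
  Real.sqrt_le_sqrt <| Finset.sum_le_sum fun i _ => Finset.sum_le_sum fun j _ =>
    sq_le_sq.mpr (h i j)

theorem frobNorm_le_card_mul {A : Matrix n n ℝ} {c : ℝ} (hc : 0 ≤ c) (h : ∀ i j, |A i j| ≤ c) :
    frobNorm A ≤ Fintype.card n * c := by
  refine Real.sqrt_le_iff.mpr ⟨by positivity, ?_⟩
  calc ∑ i, ∑ j, A i j ^ 2 ≤ ∑ _i : n, ∑ _j : n, c ^ 2 :=
        Finset.sum_le_sum fun i _ => Finset.sum_le_sum fun j _ =>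
          sq_le_sq.mpr ((h i j).trans (le_abs_self c))
    _ = (Fintype.card n * c) ^ 2 := by simp; ring

theorem sqrt_sum_mulVec_sq_le_frobNorm_mul (A : Matrix n n ℝ) (x : n → ℝ) :
    √(∑ i, (A.mulVec x i) ^ 2) ≤ frobNorm A * √(∑ i, x i ^ 2) := by
  rw [frobNorm, ← Real.sqrt_mul (by positivity), Finset.sum_mul]
  exact Real.sqrt_le_sqrt <| Finset.sum_le_sum fun i _ => Finset.sum_mul_sq_le_sq_mul_sq _ _ _

theorem sqrt_sum_mulVec_sq_le_specNorm (A : Matrix n n ℝ) {x : n → ℝ} (hx : ∑ i, x i ^ 2 = 1) :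
    √(∑ i, (A.mulVec x i) ^ 2) ≤ specNorm A := by
  refine le_ciSup (f := fun x : {x : n → ℝ // ∑ i, (x i) ^ 2 = 1} =>
    √(∑ i, (A.mulVec x.1 i) ^ 2)) ⟨frobNorm A, ?_⟩ ⟨x, hx⟩
  rintro _ ⟨y, rfl⟩
  simpa [y.2] using sqrt_sum_mulVec_sq_le_frobNorm_mul A y.1

theorem posSemidef_smul_one_sub [DecidableEq n] {A : Matrix n n ℝ} (hA : A.IsHermitian) {c : ℝ}
    (h : ∀ x : n → ℝ, ∑ i, x i ^ 2 = 1 → √(∑ i, (A.mulVec x i) ^ 2) ≤ c) :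
    (c • 1 - A).PosSemidef := by
  refine .of_dotProduct_mulVec_nonneg ((isHermitian_one.smul (IsSelfAdjoint.all c)).sub hA) fun x => ?_
  have key : x ⬝ᵥ A.mulVec x ≤ c * (x ⬝ᵥ x) := by
    rcases eq_or_ne x 0 with rfl | hx
    · simp
    have hpos : 0 < ∑ i, x i ^ 2 := by
      obtain ⟨i, hi⟩ := Function.ne_iff.mp hx
      exact Finset.sum_pos' (fun _ _ => sq_nonneg _) ⟨i, Finset.mem_univ i, sq_pos_of_ne_zero hi⟩
    set r := √(∑ i, x i ^ 2) with hr
    have hr0 : 0 < r := Real.sqrt_pos.mpr hpos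
    have hr2 : r ^ 2 = ∑ i, x i ^ 2 := Real.sq_sqrt hpos.le
    have hu : ∑ i, (r⁻¹ • x) i ^ 2 = 1 := by
      simp only [Pi.smul_apply, smul_eq_mul, mul_pow, ← Finset.mul_sum]
      rw [← hr2]
      field_simp
    have hle : (r⁻¹ • x) ⬝ᵥ A.mulVec (r⁻¹ • x) ≤ c := by
      refine (Real.sum_mul_le_sqrt_mul_sqrt _ _ _).trans ?_
      rw [hu, Real.sqrt_one, one_mul]
      exact h _ hu
    have hxx : x ⬝ᵥ x = r ^ 2 := by
      rw [hr2]
      simp [dotProduct, sq]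
    rw [mulVec_smul, smul_dotProduct, dotProduct_smul, smul_eq_mul, smul_eq_mul] at hle
    rw [hxx]
    field_simp at hle
    linarith
  simpa [sub_mulVec, smul_mulVec, dotProduct_sub, dotProduct_smul] using key

theorem posSemidef_specNorm_smul_one_sub [DecidableEq n] {A : Matrix n n ℝ} (hA : A.IsHermitian) :
    (specNorm A • 1 - A).PosSemidef :=
  posSemidef_smul_one_sub hA fun _ hx => sqrt_sum_mulVec_sq_le_specNorm A hx

theorem posSemidef_smul_one_sub_of_frobNorm_le [DecidableEq n] {A : Matrix n n ℝ}
    (hA : A.IsHermitian) {c : ℝ} (hc : frobNorm A ≤ c) : (c • 1 - A).PosSemidef :=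
  posSemidef_smul_one_sub hA fun x hx =>
    (by simpa [hx] using sqrt_sum_mulVec_sq_le_frobNorm_mul A x :
      √(∑ i, (A.mulVec x i) ^ 2) ≤ frobNorm A).trans hc

end Norms

theorem trace_mul_nonneg_of_posSemidef {n : Type*} [Fintype n] {A B : Matrix n n ℝ}
    (hA : A.PosSemidef) (hB : B.PosSemidef) : 0 ≤ (A * B).trace := by
  obtain ⟨m, v, rfl⟩ := posSemidef_iff_eq_sum_vecMulVec.mp hA
  rw [Finset.sum_mul, trace_sum]
  refine Finset.sum_nonneg fun i _ => ?_
  rw [trace_mul_comm, mul_vecMulVec, trace_vecMulVec, dotProduct_comm]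
  exact hB.dotProduct_mulVec_nonneg (v i)

theorem posDef_of_posSemidef_sub_smul_one {n : Type*} [DecidableEq n] {A : Matrix n n ℝ} {α : ℝ}
    (hα : 0 < α) (hA : (A - α • 1).PosSemidef) : A.PosDef := by
  simpa using PosDef.posSemidef_add hA (PosDef.one.smul hα)

section PosSemidef

variable {n : Type*} [Fintype n] [DecidableEq n]

theorem sq_mul_trace_le_trace_mul {A B : Matrix n n ℝ} {α : ℝ} (hα : 0 < α)
    (hA : (A - α • 1).PosSemidef) (hB : (B - α • 1).PosSemidef) (E : Matrix n n ℝ) :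
    α ^ 2 * (Eᵀ * E).trace ≤ (Eᵀ * (A * E * B)).trace := by
  have hAE : (Eᵀ * A * E).PosSemidef :=
    (posDef_of_posSemidef_sub_smul_one hα hA).posSemidef.conjTranspose_mul_mul_same E
  have h1 := trace_mul_nonneg_of_posSemidef hAE hB
  have h2 := (hA.conjTranspose_mul_mul_same E).trace_nonneg
  simp only [conjTranspose_eq_transpose_of_trivial, mul_sub, sub_mul, trace_sub, mul_smul_comm,
    smul_mul_assoc, mul_one, trace_smul, smul_eq_mul] at h1 h2
  simp only [← mul_assoc]
  nlinarith

/-- The gradient step of the log-determinant is nonexpansive above `α`. -/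
theorem frobNorm_sub_add_smul_inv_sub_inv_le {A B : Matrix n n ℝ} {α ζ : ℝ} (hα : 0 < α)
    (hζ : 0 < ζ) (hζα : ζ ≤ α ^ 2) (hA : (A - α • 1).PosSemidef) (hB : (B - α • 1).PosSemidef) :
    frobNorm (A - B + ζ • (A⁻¹ - B⁻¹)) ≤ frobNorm (A - B) := by
  have hAu : IsUnit A.det :=
    (isUnit_iff_isUnit_det A).mp (posDef_of_posSemidef_sub_smul_one hα hA).isUnit
  have hBu : IsUnit B.det :=
    (isUnit_iff_isUnit_det B).mp (posDef_of_posSemidef_sub_smul_one hα hB).isUnit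
  obtain ⟨E, hE⟩ : ∃ E, E = B⁻¹ - A⁻¹ := ⟨_, rfl⟩
  have hD : A - B = A * E * B := by
    rw [hE, mul_sub, sub_mul, mul_assoc, nonsing_inv_mul _ hBu, mul_nonsing_inv _ hAu]
    simp
  have hkey := sq_mul_trace_le_trace_mul hα hA hB E
  rw [show A - B + ζ • (A⁻¹ - B⁻¹) = (A - B) - ζ • E by rw [hE]; module, hD]
  generalize A * E * B = D at hkey
  refine le_of_sq_le_sq ?_ (frobNorm_nonneg _)
  have hcomm : (Dᵀ * E).trace = (Eᵀ * D).trace := by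
    rw [← trace_transpose, transpose_mul, transpose_transpose]
  have hEE : 0 ≤ (Eᵀ * E).trace := frobNorm_sq E ▸ sq_nonneg _
  rw [frobNorm_sq, frobNorm_sq, transpose_sub, transpose_smul, sub_mul, mul_sub, mul_sub]
  simp only [trace_sub, smul_mul_assoc, mul_smul_comm, trace_smul, smul_eq_mul, hcomm]
  have hζED : ζ * (Eᵀ * E).trace ≤ (Eᵀ * D).trace :=
    (mul_le_mul_of_nonneg_right hζα hEE).trans hkey
  have hED : 0 ≤ (Eᵀ * D).trace := (mul_nonneg hζ.le hEE).trans hζED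
  linarith [mul_le_mul_of_nonneg_left hζED hζ.le, mul_nonneg hζ.le hED]

theorem posSemidef_add_smul_inv_sub {A : Matrix n n ℝ} {α ζ : ℝ} (hα : 0 < α)
    (hζ : 0 < ζ) (hζα : ζ ≤ α ^ 2) (hA : (A - α • 1).PosSemidef) :
    (A + ζ • A⁻¹ - (α + ζ / α) • 1).PosSemidef := by
  have hpd := posDef_of_posSemidef_sub_smul_one hα hA
  have hu : IsUnit A.det := (isUnit_iff_isUnit_det A).mp hpd.isUnit
  set β := ζ / α with hβ
  have hζβ : ζ = α * β := by rw [hβ]; field_simp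
  have hβα : β ≤ α := by rw [hβ, div_le_iff₀ hα]; linarith
  obtain ⟨D, hD⟩ : ∃ D, D = A - α • (1 : Matrix n n ℝ) := ⟨_, rfl⟩
  rw [← hD] at hA
  have hpoly : (D ^ 3 + (2 * α - β) • D ^ 2 + (α * (α - β)) • D).PosSemidef :=
    ((hA.pow 3).add ((hA.pow 2).smul (by linarith))).add
      (hA.smul (mul_nonneg hα.le (by linarith)))
  have heq : D ^ 3 + (2 * α - β) • D ^ 2 + (α * (α - β)) • D
      = A * (A + ζ • A⁻¹ - (α + β) • 1) * A := by
    have hr : A * (A + ζ • A⁻¹ - (α + β) • 1) * A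
        = A * A * A + ζ • A - (α + β) • (A * A) := by
      simp only [mul_sub, mul_add, sub_mul, add_mul, mul_smul_comm, smul_mul_assoc, mul_one,
        mul_nonsing_inv _ hu, one_mul]
    rw [hr, hζβ, hD]
    simp only [pow_succ, pow_zero, one_mul, mul_sub, sub_mul, mul_smul_comm, smul_mul_assoc,
      mul_one]
    module
  have h := hpoly.conjTranspose_mul_mul_same A⁻¹
  rw [hpd.inv.isHermitian.eq, heq] at h
  rwa [← mul_assoc, ← mul_assoc, nonsing_inv_mul _ hu, one_mul, mul_assoc,
    mul_nonsing_inv _ hu, mul_one] at h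

end PosSemidef

theorem isHermitian_softThresh {n : Type*} [Fintype n] {X : Matrix n n ℝ} (hX : X.IsHermitian)
    (c : ℝ) : (softThresh c X).IsHermitian := by
  refine IsHermitian.ext fun i j => ?_
  have h : X j i = X i j := hX.apply i j
  simp [softThresh, h]

theorem frobNorm_softThresh_sub_softThresh_le {n : Type*} [Fintype n] {c : ℝ} (hc : 0 ≤ c)
    (X Y : Matrix n n ℝ) : frobNorm (softThresh c X - softThresh c Y) ≤ frobNorm (X - Y) :=
  frobNorm_le_frobNorm fun _ _ => abs_sign_mul_max_sub_sign_mul_max_le hc _ _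

theorem frobNorm_sub_softThresh_le {n : Type*} [Fintype n] {c : ℝ} (hc : 0 ≤ c)
    (X : Matrix n n ℝ) : frobNorm (X - softThresh c X) ≤ Fintype.card n * c :=
  frobNorm_le_card_mul hc fun i j => by
    rw [Matrix.sub_apply, abs_sub_comm]
    exact abs_sign_mul_max_sub_le hc _

/-- One G-ISTA step with step size at most `α ^ 2` preserves the lower bound `α`. -/
theorem posSemidef_softThresh_step_sub {n : Type*} [Fintype n] [DecidableEq n] {S A : Matrix n n ℝ}
    (hS : S.IsHermitian) {ρ α ζ : ℝ} (hρ : 0 < ρ) (hα : 0 < α)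
    (hα' : α⁻¹ = specNorm S + Fintype.card n * ρ) (hζ : 0 < ζ) (hζα : ζ ≤ α ^ 2)
    (hA : (A - α • 1).PosSemidef) :
    (softThresh (ζ * ρ) (A - ζ • (S - A⁻¹)) - α • 1).PosSemidef := by
  have hpd := posDef_of_posSemidef_sub_smul_one hα hA
  set X := A - ζ • (S - A⁻¹) with hX
  have hXh : X.IsHermitian :=
    hpd.isHermitian.sub ((hS.sub hpd.inv.isHermitian).smul (IsSelfAdjoint.all ζ))
  have h1 := posSemidef_add_smul_inv_sub hα hζ hζα hA
  have h2 := (posSemidef_specNorm_smul_one_sub hS).smul hζ.le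
  have h3 := posSemidef_smul_one_sub_of_frobNorm_le (hXh.sub (isHermitian_softThresh hXh (ζ * ρ)))
    (frobNorm_sub_softThresh_le (by positivity) X)
  convert (h1.add h2).add h3 using 1
  rw [div_eq_mul_inv, hα', hX]
  module

/-- The G-ISTA iterates stay bounded in eigenvalue:
`αI ⪯ Θ_t ⪯ b′I` with `b′ = ‖Θ*‖₂ + ‖Θ₀ − Θ*‖_F`. -/
theorem gista_iterates_eigenvalue_bounds {p : ℕ} (hp : 0 < p)
    (S : Matrix (Fin p) (Fin p) ℝ) (hS : S.PosSemidef)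
    (ρ : ℝ) (hρ : 0 < ρ)
    (α : ℝ) (hα : α = 1 / (specNorm S + p * ρ))
    (Θs : Matrix (Fin p) (Fin p) ℝ) (hΘs : Θs.PosDef)
    (hΘslb : (Θs - α • 1).PosSemidef)
    (hfix : ∀ ζ : ℝ, 0 < ζ → ζ ≤ α ^ 2 →
      Θs = softThresh (ζ * ρ) (Θs - ζ • (S - Θs⁻¹)))
    (Θ : ℕ → Matrix (Fin p) (Fin p) ℝ) (hΘ0 : (Θ 0).PosDef)
    (hΘ0lb : (Θ 0 - α • 1).PosSemidef)
    (ζ : ℕ → ℝ) (hζ : ∀ t, 0 < ζ t ∧ ζ t ≤ α ^ 2)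
    (hiter : ∀ t, Θ (t + 1) = softThresh (ζ t * ρ) (Θ t - ζ t • (S - (Θ t)⁻¹)))
    (b' : ℝ) (hb' : b' = specNorm Θs + frobNorm (Θ 0 - Θs)) :
    ∀ t, (Θ t - α • 1).PosSemidef ∧ (b' • 1 - Θ t).PosSemidef := by
  have hs := specNorm_nonneg S
  have hpρ : 0 < (p : ℝ) * ρ := by positivity
  have hα0 : 0 < α := hα ▸ by positivity
  have hα' : α⁻¹ = specNorm S + Fintype.card (Fin p) * ρ := by simp [hα]
  have hlow : ∀ t, (Θ t - α • 1).PosSemidef := fun t => by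
    induction t with
    | zero => exact hΘ0lb
    | succ t ih =>
      rw [hiter t]
      exact posSemidef_softThresh_step_sub hS.isHermitian hρ hα0 hα' (hζ t).1 (hζ t).2 ih
  have hdist : ∀ t, frobNorm (Θ t - Θs) ≤ frobNorm (Θ 0 - Θs) := fun t => by
    induction t with
    | zero => exact le_rfl
    | succ t ih =>
      obtain ⟨hζ0, hζα⟩ := hζ t
      refine le_trans ?_ ih
      calc frobNorm (Θ (t + 1) - Θs)
          = frobNorm (softThresh (ζ t * ρ) (Θ t - ζ t • (S - (Θ t)⁻¹))
              - softThresh (ζ t * ρ) (Θs - ζ t • (S - Θs⁻¹))) := by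
            rw [← hiter t, ← hfix (ζ t) hζ0 hζα]
        _ ≤ frobNorm ((Θ t - ζ t • (S - (Θ t)⁻¹)) - (Θs - ζ t • (S - Θs⁻¹))) :=
            frobNorm_softThresh_sub_softThresh_le (by positivity) _ _
        _ = frobNorm (Θ t - Θs + ζ t • ((Θ t)⁻¹ - Θs⁻¹)) := by
            congr 1
            module
        _ ≤ frobNorm (Θ t - Θs) :=
            frobNorm_sub_add_smul_inv_sub_inv_le hα0 hζ0 hζα (hlow t) hΘslb
  refine fun t => ⟨hlow t, ?_⟩
  have hΘt := (posDef_of_posSemidef_sub_smul_one hα0 (hlow t)).isHermitian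
  convert (posSemidef_specNorm_smul_one_sub hΘs.isHermitian).add
    (posSemidef_smul_one_sub_of_frobNorm_le (hΘt.sub hΘs.isHermitian) (hdist t)) using 1
  rw [hb']
  module
end

section
/- Let ζ > 0 and let A and B be p×p real symmetric positive definite matrices. Set a = min(λ_min(A), λ_min(B)) and b = max(λ_max(A), λ_max(B)). Then ‖(A + ζA⁻¹) − (B + ζB⁻¹)‖_F ≤ max{|1 − ζ/b²|, |1 − ζ/a²|} · ‖A − B‖_F. -/
open Matrix

lemma frobNorm_eq_sqrt_trace {n : Type*} [Fintype n] (M : Matrix n n ℝ) :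
    frobNorm M = Real.sqrt (Mᵀ * M).trace := by
  simp only [frobNorm, Matrix.trace, Matrix.diag, Matrix.mul_apply, Matrix.transpose_apply, ← pow_two]
  rw [Finset.sum_comm]

/-- The Frobenius norm is invariant under multiplication by orthogonal matrices. -/
lemma frobNorm_transpose_mul_mul {n : Type*} [Fintype n] [DecidableEq n]
    (U V M : Matrix n n ℝ) (hU : U * Uᵀ = 1) (hV : V * Vᵀ = 1) :
    frobNorm (Uᵀ * M * V) = frobNorm M := by
  rw [frobNorm_eq_sqrt_trace, frobNorm_eq_sqrt_trace]
  congr 1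
  calc ((Uᵀ * M * V)ᵀ * (Uᵀ * M * V)).trace
      = (Vᵀ * (Mᵀ * (U * Uᵀ) * M * V)).trace := by
        simp only [Matrix.transpose_mul, Matrix.transpose_transpose, Matrix.mul_assoc]
    _ = (Mᵀ * M * (V * Vᵀ)).trace := by
        rw [hU, Matrix.mul_one, Matrix.trace_mul_comm, Matrix.mul_assoc]
    _ = (Mᵀ * M).trace := by rw [hV, Matrix.mul_one]

lemma frobNorm_le_mul_of_abs_le {n : Type*} [Fintype n] {M N : Matrix n n ℝ} {c : ℝ} (hc : 0 ≤ c)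
    (h : ∀ i j, |M i j| ≤ c * |N i j|) : frobNorm M ≤ c * frobNorm N := by
  unfold frobNorm
  rw [← Real.sqrt_sq hc, ← Real.sqrt_mul (sq_nonneg c)]
  apply Real.sqrt_le_sqrt
  simp only [Finset.mul_sum]
  refine Finset.sum_le_sum fun i _ => Finset.sum_le_sum fun j _ => ?_
  rw [← sq_abs (M i j), ← sq_abs (N i j), ← mul_pow]
  exact pow_le_pow_left₀ (abs_nonneg _) (h i j) 2

/-- Orthogonal diagonalization of a real symmetric matrix. -/
lemma Matrix.IsHermitian.exists_orthogonal_diagonalization {n : Type*} [Fintype n] [DecidableEq n]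
    {A : Matrix n n ℝ} (hA : A.IsHermitian) :
    ∃ (U : Matrix n n ℝ) (d : n → ℝ),
      Uᵀ * U = 1 ∧ U * Uᵀ = 1 ∧ A = U * Matrix.diagonal d * Uᵀ := by
  have hstar : star (hA.eigenvectorUnitary : Matrix n n ℝ) =
      (hA.eigenvectorUnitary : Matrix n n ℝ)ᵀ := by
    rw [Matrix.star_eq_conjTranspose, Matrix.conjTranspose_eq_transpose_of_trivial]
  refine ⟨hA.eigenvectorUnitary, hA.eigenvalues, ?_, ?_, ?_⟩
  · rw [← hstar]
    exact Unitary.coe_star_mul_self _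
  · rw [← hstar]
    exact Unitary.coe_mul_star_self _
  · conv_lhs => rw [hA.spectral_theorem, Unitary.conjStarAlgAut_apply]
    rw [← hstar]
    rfl

lemma isCompact_sum_sq_eq_one (n : Type*) [Fintype n] :
    IsCompact {x : n → ℝ | ∑ i, (x i) ^ 2 = 1} := by
  refine Metric.isCompact_of_isClosed_isBounded
    (isClosed_eq (by fun_prop) continuous_const) ?_
  refine (Metric.isBounded_closedBall (x := (0 : n → ℝ)) (r := 1)).subset fun x hx => ?_
  rw [mem_closedBall_zero_iff, pi_norm_le_iff_of_nonneg zero_le_one]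
  intro i
  rw [Real.norm_eq_abs, ← sq_le_one_iff_abs_le_one, ← show ∑ i, (x i) ^ 2 = 1 from hx]
  exact Finset.single_le_sum (f := fun i => (x i) ^ 2) (fun j _ => sq_nonneg _) (Finset.mem_univ i)

lemma continuous_dotProduct_mulVec_self {n : Type*} [Fintype n] (A : Matrix n n ℝ) :
    Continuous fun x : n → ℝ => x ⬝ᵥ A.mulVec x :=
  continuous_id.dotProduct (continuous_const.matrix_mulVec continuous_id)

lemma lmin_le {n : Type*} [Fintype n] (A : Matrix n n ℝ) {x : n → ℝ} (hx : ∑ i, (x i) ^ 2 = 1) :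
    lmin A ≤ x ⬝ᵥ A.mulVec x := by
  have h := (isCompact_sum_sq_eq_one n).bddBelow_image
    (continuous_dotProduct_mulVec_self A).continuousOn
  rw [Set.image_eq_range] at h
  exact ciInf_le h ⟨x, hx⟩

lemma le_lmax {n : Type*} [Fintype n] (A : Matrix n n ℝ) {x : n → ℝ} (hx : ∑ i, (x i) ^ 2 = 1) :
    x ⬝ᵥ A.mulVec x ≤ lmax A := by
  have h := (isCompact_sum_sq_eq_one n).bddAbove_image
    (continuous_dotProduct_mulVec_self A).continuousOn
  rw [Set.image_eq_range] at h
  exact le_ciSup h ⟨x, hx⟩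

lemma Matrix.PosDef.lmin_pos {n : Type*} [Fintype n] [Nonempty n] {A : Matrix n n ℝ}
    (hA : A.PosDef) : 0 < lmin A := by
  classical
  have hne : {x : n → ℝ | ∑ i, (x i) ^ 2 = 1}.Nonempty :=
    ⟨Pi.single (Classical.arbitrary n) 1, by simp [Pi.single_apply]⟩
  obtain ⟨x, hx, hmin⟩ := (isCompact_sum_sq_eq_one n).exists_isMinOn hne
    (continuous_dotProduct_mulVec_self A).continuousOn
  have hx0 : x ≠ 0 := by
    rintro rfl
    simp at hx
  have hpos : 0 < x ⬝ᵥ A.mulVec x := by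
    simpa using hA.dotProduct_mulVec_pos hx0
  have : Nonempty {x : n → ℝ // ∑ i, (x i) ^ 2 = 1} := ⟨⟨x, hx⟩⟩
  exact hpos.trans_le (le_ciInf fun y => hmin y.2)

/-- The eigenvalues of an orthogonally diagonalized matrix lie between `lmin` and `lmax`. -/
lemma eigenvalue_mem_Icc_lmin_lmax {n : Type*} [Fintype n] [DecidableEq n]
    {A U : Matrix n n ℝ} {d : n → ℝ} (hU : Uᵀ * U = 1) (hA : A = U * Matrix.diagonal d * Uᵀ)
    (i : n) : d i ∈ Set.Icc (lmin A) (lmax A) := by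
  have hx : ∑ k, (U k i) ^ 2 = 1 := by
    simpa [Matrix.mul_apply, pow_two] using congrFun (congrFun hU i) i
  have hd : (fun k => U k i) ⬝ᵥ A.mulVec (fun k => U k i) = d i := by
    have h : Uᵀ * (A * U) = Matrix.diagonal d := by
      rw [hA, Matrix.mul_assoc, hU, Matrix.mul_one, ← Matrix.mul_assoc, hU, Matrix.one_mul]
    simpa [Matrix.mul_apply, dotProduct, Matrix.mulVec] using congrFun (congrFun h i) i
  exact ⟨(lmin_le A hx).trans_eq hd, hd.symm.trans_le (le_lmax A hx)⟩

lemma inv_orthogonal_diagonalization {n : Type*} [Fintype n] [DecidableEq n]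
    {U : Matrix n n ℝ} {d : n → ℝ} (hU : Uᵀ * U = 1) (hU' : U * Uᵀ = 1) (hd : ∀ i, d i ≠ 0) :
    (U * Matrix.diagonal d * Uᵀ)⁻¹ = U * Matrix.diagonal (fun i => (d i)⁻¹) * Uᵀ := by
  apply Matrix.inv_eq_right_inv
  calc U * Matrix.diagonal d * Uᵀ * (U * Matrix.diagonal (fun i => (d i)⁻¹) * Uᵀ)
      = U * (Matrix.diagonal d * (Uᵀ * U) * Matrix.diagonal (fun i => (d i)⁻¹)) * Uᵀ := by
        simp only [Matrix.mul_assoc]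
    _ = 1 := by simp [hU, hU', hd, Matrix.diagonal_mul_diagonal]

lemma transpose_mul_sub_mul_apply {n : Type*} [Fintype n] [DecidableEq n]
    {U V : Matrix n n ℝ} (hU : Uᵀ * U = 1) (hV : Vᵀ * V = 1) (d e : n → ℝ) (i j : n) :
    (Uᵀ * (U * Matrix.diagonal d * Uᵀ - V * Matrix.diagonal e * Vᵀ) * V) i j =
      (d i - e j) * (Uᵀ * V) i j := by
  have h : Uᵀ * (U * Matrix.diagonal d * Uᵀ - V * Matrix.diagonal e * Vᵀ) * V =
      (Uᵀ * U) * Matrix.diagonal d * (Uᵀ * V) - (Uᵀ * V) * Matrix.diagonal e * (Vᵀ * V) := by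
    simp only [Matrix.mul_sub, Matrix.sub_mul, Matrix.mul_assoc]
  rw [h, hU, hV, Matrix.one_mul, Matrix.mul_one, Matrix.sub_apply, Matrix.diagonal_mul,
    Matrix.mul_diagonal]
  ring

lemma add_smul_diagonalization {n : Type*} [Fintype n] [DecidableEq n]
    (U : Matrix n n ℝ) (d e : n → ℝ) (ζ : ℝ) :
    U * Matrix.diagonal d * Uᵀ + ζ • (U * Matrix.diagonal e * Uᵀ) =
      U * Matrix.diagonal (fun i => d i + ζ * e i) * Uᵀ := by
  have h : Matrix.diagonal (fun i => d i + ζ * e i) =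
      Matrix.diagonal d + ζ • Matrix.diagonal e := by
    rw [← Matrix.diagonal_smul, Matrix.diagonal_add]
    rfl
  rw [h, Matrix.mul_add, Matrix.add_mul, Matrix.mul_smul, Matrix.smul_mul]

lemma abs_add_div_sub_le {ζ a b s t : ℝ} (hζ : 0 ≤ ζ) (ha : 0 < a)
    (hs : s ∈ Set.Icc a b) (ht : t ∈ Set.Icc a b) :
    |s + ζ * s⁻¹ - (t + ζ * t⁻¹)| ≤ max |1 - ζ / b ^ 2| |1 - ζ / a ^ 2| * |s - t| := by
  have hs0 : 0 < s := ha.trans_le hs.1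
  have ht0 : 0 < t := ha.trans_le ht.1
  have hfactor : s + ζ * s⁻¹ - (t + ζ * t⁻¹) = (1 - ζ / (s * t)) * (s - t) := by
    field_simp
    ring
  rw [hfactor, abs_mul, max_comm]
  refine mul_le_mul_of_nonneg_right (abs_le_max_abs_abs ?_ ?_) (abs_nonneg _)
  · refine sub_le_sub_left (div_le_div_of_nonneg_left hζ (by positivity) ?_) 1
    rw [pow_two]
    exact mul_le_mul hs.1 ht.1 ha.le hs0.le
  · refine sub_le_sub_left (div_le_div_of_nonneg_left hζ (by positivity) ?_) 1
    rw [pow_two]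
    exact mul_le_mul hs.2 ht.2 ht0.le (hs0.le.trans hs.2)

/-- Contraction property of the map `A ↦ A + ζA⁻¹` in the Frobenius norm:
`‖(A + ζA⁻¹) − (B + ζB⁻¹)‖_F ≤ max{|1 − ζ/b²|, |1 − ζ/a²|} ‖A − B‖_F`
with `a = min(λmin A, λmin B)`, `b = max(λmax A, λmax B)`. -/
theorem add_smul_inv_contraction {p : ℕ} (hp : 0 < p) (ζ : ℝ) (hζ : 0 < ζ)
    (A B : Matrix (Fin p) (Fin p) ℝ) (hA : A.PosDef) (hB : B.PosDef) :
    frobNorm ((A + ζ • A⁻¹) - (B + ζ • B⁻¹)) ≤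
      max |1 - ζ / (max (lmax A) (lmax B)) ^ 2|
          |1 - ζ / (min (lmin A) (lmin B)) ^ 2| * frobNorm (A - B) := by
  have : Nonempty (Fin p) := ⟨⟨0, hp⟩⟩
  have ha : 0 < min (lmin A) (lmin B) := lt_min hA.lmin_pos hB.lmin_pos
  obtain ⟨U, d, hU, hU', hAd⟩ := hA.isHermitian.exists_orthogonal_diagonalization
  obtain ⟨V, e, hV, hV', hBe⟩ := hB.isHermitian.exists_orthogonal_diagonalization
  have hd : ∀ i, d i ∈ Set.Icc (min (lmin A) (lmin B)) (max (lmax A) (lmax B)) := fun i =>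
    Set.Icc_subset_Icc (min_le_left _ _) (le_max_left _ _) (eigenvalue_mem_Icc_lmin_lmax hU hAd i)
  have he : ∀ i, e i ∈ Set.Icc (min (lmin A) (lmin B)) (max (lmax A) (lmax B)) := fun i =>
    Set.Icc_subset_Icc (min_le_right _ _) (le_max_right _ _) (eigenvalue_mem_Icc_lmin_lmax hV hBe i)
  have hAinv : A + ζ • A⁻¹ = U * Matrix.diagonal (fun i => d i + ζ * (d i)⁻¹) * Uᵀ := by
    rw [hAd, inv_orthogonal_diagonalization hU hU' fun i => (ha.trans_le (hd i).1).ne',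
      add_smul_diagonalization]
  have hBinv : B + ζ • B⁻¹ = V * Matrix.diagonal (fun i => e i + ζ * (e i)⁻¹) * Vᵀ := by
    rw [hBe, inv_orthogonal_diagonalization hV hV' fun i => (ha.trans_le (he i).1).ne',
      add_smul_diagonalization]
  rw [← frobNorm_transpose_mul_mul U V _ hU' hV', ← frobNorm_transpose_mul_mul U V (A - B) hU' hV']
  refine frobNorm_le_mul_of_abs_le ((abs_nonneg _).trans (le_max_left _ _)) fun i j => ?_
  have hsub : (Uᵀ * (A - B) * V) i j = (d i - e j) * (Uᵀ * V) i j := by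
    rw [← transpose_mul_sub_mul_apply hU hV, ← hAd, ← hBe]
  rw [hAinv, hBinv, transpose_mul_sub_mul_apply hU hV, hsub, abs_mul, abs_mul, ← mul_assoc]
  exact mul_le_mul_of_nonneg_right (abs_add_div_sub_le hζ.le ha (hd i) (he j)) (abs_nonneg _)
end
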